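/- arXiv:1502.07118 — 2 statements merged into one kernel-verified Lean document; each statement's English description precedes it below -/
import Mathlib

section
/- For stack, local linearizability is incomparable to sequential consistency: (i) there exists a concurrent history over Σ_S that is sequentially consistent with respect to S_S but not locally linearizable with respect to S_S; and (ii) there exists a concurrent history over Σ_S that is locally linearizable with respect to S_S but not sequentially consistent with respect to S_S. -/
namespace LL

universe u v w

/-- Method calls of a container alphabet: insertions `ins x` of a value `x ∈ V`,
and removals `rem v` of a value `v ∈ V` or returning an "empty" value in `E`. -/
inductive CMethod (V : Type u) (E : Type v) where
  | ins : V → CMethod V E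
  | rem : V ⊕ E → CMethod V E

/-- Events of a concurrent history: invocations and responses of method calls
in `σ`, tagged with a thread identifier in `I`. -/
inductive Event (σ : Type u) (I : Type v) where
  | inv : σ → I → Event σ I
  | res : σ → I → Event σ I

variable {σ : Type*} {I : Type*} {V : Type*} {E : Type*} {α : Type*}

/-- The method call of an event. -/
def Event.method : Event σ I → σ
  | .inv m _ => m
  | .res m _ => m

/-- The thread identifier of an event. -/
def Event.thread : Event σ I → I
  | .inv _ k => k
  | .res _ k => k

/-- Whether an event is an invocation. -/
def Event.isInv : Event σ I → Bool
  | .inv _ _ => true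
  | .res _ _ => false

/-- `a` occurs (strictly) before `b` in the sequence `s`. -/
def OccursBefore (s : List α) (a b : α) : Prop :=
  ∃ i j : Fin s.length, i < j ∧ s.get i = a ∧ s.get j = b

/-- A set of sequences is prefix-closed. -/
def PrefixClosed (S : Set (List α)) : Prop :=
  ∀ s ∈ S, ∀ t : List α, t <+: s → t ∈ S

open Classical in
/-- The subsequence of events of thread `k`. -/
noncomputable def threadEvents (h : List (Event σ I)) (k : I) : List (Event σ I) :=
  h.filter fun e => decide (e.thread = k)

/-- `h` is a well-formed concurrent history: no event occurs twice, each method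
call is invoked at most once, every response is preceded by its matching
invocation, and in every thread's subsequence of events each invocation is
immediately followed by its matching response. -/
structure IsHistory (h : List (Event σ I)) : Prop where
  nodup : h.Nodup
  invUnique : ∀ (i j : Fin h.length) (m : σ) (k k' : I),
      h.get i = Event.inv m k → h.get j = Event.inv m k' → i = j
  resMatched : ∀ (j : Fin h.length) (m : σ) (k : I), h.get j = Event.res m k →
      ∃ i : Fin h.length, i < j ∧ h.get i = Event.inv m k
  threadSeq : ∀ (k : I) (i : ℕ) (m : σ),
      (threadEvents h k)[i]? = some (Event.inv m k) →
      ∀ e : Event σ I, (threadEvents h k)[i + 1]? = some e → e = Event.res m k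

/-- The method call `m` appears in `h` (its invocation occurs in `h`). -/
def Appears (h : List (Event σ I)) (m : σ) : Prop :=
  ∃ k : I, Event.inv m k ∈ h

/-- `h` is complete: every invocation has its matching response in `h`. -/
def HistComplete (h : List (Event σ I)) : Prop :=
  ∀ (m : σ) (k : I), Event.inv m k ∈ h → Event.res m k ∈ h

/-- The method call `m` (executed by thread `k`) is pending in `h`. -/
def PendingCall (h : List (Event σ I)) (m : σ) (k : I) : Prop :=
  Event.inv m k ∈ h ∧ Event.res m k ∉ h

/-- `hc` is a completion of `h`: a complete well-formed history obtained from `h`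
by deleting some pending invocations and appending matching responses for the
remaining pending invocations. -/
def IsCompletionOf (hc h : List (Event σ I)) : Prop :=
  IsHistory hc ∧ HistComplete hc ∧
  ∃ h' r : List (Event σ I),
    h'.Sublist h ∧
    (∀ e ∈ h, e ∉ h' → ∃ (m : σ) (k : I), e = Event.inv m k ∧ PendingCall h m k) ∧
    (∀ e ∈ r, ∃ (m : σ) (k : I), e = Event.res m k ∧ PendingCall h m k) ∧
    hc = h' ++ r

/-- The precedence order of `h`: `m <_h n` iff the response of `m` occurs in `h`
before the invocation of `n`. -/
def Precedes (h : List (Event σ I)) (m n : σ) : Prop :=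
  ∃ (i j : Fin h.length) (k k' : I),
    i < j ∧ h.get i = Event.res m k ∧ h.get j = Event.inv n k'

/-- The sequence of method calls of a history (in invocation order). -/
def methodList (h : List (Event σ I)) : List σ :=
  (h.filter Event.isInv).map Event.method

/-- `h` is linearizable wrt the sequential specification `S`. -/
def Linearizable (S : Set (List σ)) (h : List (Event σ I)) : Prop :=
  ∃ hc : List (Event σ I), IsCompletionOf hc h ∧
    ∃ s ∈ S, s.Perm (methodList hc) ∧
      ∀ m n : σ, Precedes hc m n → OccursBefore s m n

/-- `h` is sequentially consistent wrt `S`. -/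
def SeqConsistent (S : Set (List σ)) (h : List (Event σ I)) : Prop :=
  ∃ hc : List (Event σ I), IsCompletionOf hc h ∧
    ∃ s ∈ S, s.Perm (methodList hc) ∧
      ∀ m n : σ, Precedes hc m n →
        (∃ k : I, Event.inv m k ∈ hc ∧ Event.inv n k ∈ hc) →
        OccursBefore s m n

/-- Position `p` is a quiescent state of `h`: every invocation occurring before
position `p` has its matching response before position `p`. -/
def QuiescentAt (h : List (Event σ I)) (p : ℕ) : Prop :=
  ∀ (i : Fin h.length) (m : σ) (k : I), (i : ℕ) < p → h.get i = Event.inv m k →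
    ∃ j : Fin h.length, (j : ℕ) < p ∧ h.get j = Event.res m k

/-- `h` is quiescently consistent wrt `S`. -/
def QuiescentConsistent (S : Set (List σ)) (h : List (Event σ I)) : Prop :=
  ∃ hc : List (Event σ I), IsCompletionOf hc h ∧
    ∃ s ∈ S, s.Perm (methodList hc) ∧
      ∀ m n : σ,
        (∃ p : ℕ, QuiescentAt hc p ∧
          (∃ (i : Fin hc.length) (k : I), (i : ℕ) < p ∧ hc.get i = Event.res m k) ∧
          (∃ (j : Fin hc.length) (k : I), p ≤ (j : ℕ) ∧ hc.get j = Event.inv n k)) →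
        OccursBefore s m n

/-- Membership of a method call in `I_T ∪ O_T`: insertions performed by thread
`T` in `h`, removals of values inserted by `T` in `h`, and removals returning an
"empty" value. -/
def InducedMethod (h : List (Event (CMethod V E) I)) (T : I) : CMethod V E → Prop
  | .ins x => Event.inv (CMethod.ins x) T ∈ h
  | .rem (Sum.inl x) => Event.inv (CMethod.ins x) T ∈ h
  | .rem (Sum.inr _) => True

open Classical in
/-- The thread-induced history `h_T`: the subsequence of `h` of events of method
calls in `I_T ∪ O_T`. -/
noncomputable def threadInduced (h : List (Event (CMethod V E) I)) (T : I) :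
    List (Event (CMethod V E) I) :=
  h.filter fun e => decide (InducedMethod h T e.method)

/-- `h` is locally linearizable wrt `S`: every thread-induced history is
linearizable wrt `S`, and the thread-induced histories decompose `h`. -/
def LocallyLinearizable (S : Set (List (CMethod V E)))
    (h : List (Event (CMethod V E) I)) : Prop :=
  (∀ T : I, Linearizable S (threadInduced h T)) ∧
  (∀ m : CMethod V E, Appears h m → ∃ T : I, InducedMethod h T m)

/-- The pool sequential specification `S_P`. -/
def poolSpec (V : Type u) (E : Type v) : Set (List (CMethod V E)) :=
  { s | s.Nodup ∧
    (∀ x : V, CMethod.rem (Sum.inl x) ∈ s →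
      CMethod.ins x ∈ s ∧
      OccursBefore s (CMethod.ins x) (CMethod.rem (Sum.inl x))) ∧
    (∀ (e : E) (x : V),
      OccursBefore s (CMethod.ins x) (CMethod.rem (Sum.inr e)) →
      CMethod.rem (Sum.inl x) ∈ s ∧
      OccursBefore s (CMethod.rem (Sum.inl x)) (CMethod.rem (Sum.inr e))) }

/-- The queue sequential specification `S_Q` (pool axioms plus queue order). -/
def queueSpec (V : Type u) (E : Type v) : Set (List (CMethod V E)) :=
  { s | s ∈ poolSpec V E ∧
    ∀ x y : V, OccursBefore s (CMethod.ins x) (CMethod.ins y) →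
      CMethod.rem (Sum.inl y) ∈ s →
      CMethod.rem (Sum.inl x) ∈ s ∧
      OccursBefore s (CMethod.rem (Sum.inl x)) (CMethod.rem (Sum.inl y)) }

/-- The stack sequential specification `S_S` (pool axioms plus stack order). -/
def stackSpec (V : Type u) (E : Type v) : Set (List (CMethod V E)) :=
  { s | s ∈ poolSpec V E ∧
    ∀ x y : V, OccursBefore s (CMethod.ins x) (CMethod.ins y) →
      OccursBefore s (CMethod.ins y) (CMethod.rem (Sum.inl x)) →
      CMethod.rem (Sum.inl y) ∈ s ∧
      OccursBefore s (CMethod.rem (Sum.inl y)) (CMethod.rem (Sum.inl x)) }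

/-- A method call's value lies in `V' ∪ Emp`. -/
def ProjKeep (V' : Set V) : CMethod V E → Prop
  | .ins x => x ∈ V'
  | .rem (Sum.inl x) => x ∈ V'
  | .rem (Sum.inr _) => True

open Classical in
/-- The data-projection of a sequence: the subsequence of method calls whose
value lies in `V' ∪ Emp`. -/
noncomputable def dataProj (V' : Set V) (s : List (CMethod V E)) :
    List (CMethod V E) :=
  s.filter fun m => decide (ProjKeep V' m)

/-- `S` is closed under data-projection. -/
def ClosedUnderDataProjection (S : Set (List (CMethod V E))) : Prop :=
  ∀ s ∈ S, ∀ V' : Set V, dataProj V' s ∈ S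

end LL

namespace LL

section SequentialHistories

variable {σ : Type*} {I : Type*} {V : Type*} {E : Type*} {α : Type*}

@[simp]
theorem occursBefore_nil (a b : α) : ¬ OccursBefore [] a b := by
  rintro ⟨i, -⟩
  exact i.elim0

@[simp]
theorem occursBefore_cons (c : α) (s : List α) (a b : α) :
    OccursBefore (c :: s) a b ↔ (a = c ∧ b ∈ s) ∨ OccursBefore s a b := by
  constructor
  · rintro ⟨i, j, hij, hi, hj⟩
    cases j using Fin.cases with
    | zero => exact absurd hij (Nat.not_lt_zero _)
    | succ j =>
      cases i using Fin.cases with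
      | zero => exact .inl ⟨hi.symm, hj ▸ List.get_mem s j⟩
      | succ i => exact .inr ⟨i, j, Fin.succ_lt_succ_iff.1 hij, hi, hj⟩
  · rintro (⟨rfl, hb⟩ | ⟨i, j, hij, hi, hj⟩)
    · obtain ⟨j, hj⟩ := List.get_of_mem hb
      exact ⟨0, j.succ, Fin.succ_pos j, rfl, hj⟩
    · exact ⟨i.succ, j.succ, Fin.succ_lt_succ_iff.2 hij, hi, hj⟩

theorem OccursBefore.trans {s : List α} (hs : s.Nodup) {a b c : α}
    (hab : OccursBefore s a b) (hbc : OccursBefore s b c) : OccursBefore s a c := by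
  obtain ⟨i, j, hij, hi, hj⟩ := hab
  obtain ⟨j', k, hjk, hj', hk⟩ := hbc
  obtain rfl : j = j' := List.nodup_iff_injective_get.1 hs (hj.trans hj'.symm)
  exact ⟨i, k, hij.trans hjk, hi, hk⟩

theorem OccursBefore.asymm {s : List α} (hs : s.Nodup) {a b : α}
    (hab : OccursBefore s a b) : ¬ OccursBefore s b a := by
  intro hba
  obtain ⟨i, j, hij, hi, hj⟩ := hab.trans hs hba
  exact hij.ne (List.nodup_iff_injective_get.1 hs (hi.trans hj.symm))

theorem precedes_iff_occursBefore (h : List (Event σ I)) (m n : σ) :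
    Precedes h m n ↔
      ∃ k k' : I, OccursBefore h (Event.res m k) (Event.inv n k') := by
  constructor
  · rintro ⟨i, j, k, k', H⟩
    exact ⟨k, k', i, j, H⟩
  · rintro ⟨k, k', i, j, H⟩
    exact ⟨i, j, _, _, H⟩

/-- A complete history is its own unique completion. -/
theorem isCompletionOf_iff_eq {h : List (Event σ I)} (hh : IsHistory h)
    (hcomp : HistComplete h) (hc : List (Event σ I)) :
    IsCompletionOf hc h ↔ hc = h := by
  have not_pending : ∀ m k, ¬ PendingCall h m k := fun m k hp => hp.2 (hcomp m k hp.1)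
  constructor
  · rintro ⟨-, -, h', r, hsub, hdel, happ, rfl⟩
    have hr : r = [] := List.eq_nil_iff_forall_not_mem.2 fun e he => by
      obtain ⟨m, k, -, hp⟩ := happ e he
      exact not_pending m k hp
    have hmem : h ⊆ h' := fun e he => by
      by_contra hne
      obtain ⟨m, k, -, hp⟩ := hdel e he hne
      exact not_pending m k hp
    rw [hr, List.append_nil]
    exact hsub.eq_of_length_le (hh.nodup.subperm hmem).length_le
  · rintro rfl
    exact ⟨hh, hcomp, hc, [], List.Sublist.refl _, fun e he hne => absurd he hne,
      by simp, by simp⟩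

/-- The history executing the given method calls one after the other, each by the
thread it is paired with. -/
def seqHistory (ops : List (σ × I)) : List (Event σ I) :=
  ops.flatMap fun o => [Event.inv o.1 o.2, Event.res o.1 o.2]

@[simp]
theorem seqHistory_nil : seqHistory ([] : List (σ × I)) = [] := rfl

@[simp]
theorem seqHistory_cons (o : σ × I) (ops : List (σ × I)) :
    seqHistory (o :: ops) =
      Event.inv o.1 o.2 :: Event.res o.1 o.2 :: seqHistory ops := rfl

@[simp]
theorem inv_mem_seqHistory {ops : List (σ × I)} {m : σ} {k : I} :
    Event.inv m k ∈ seqHistory ops ↔ (m, k) ∈ ops := by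
  simp [seqHistory]

@[simp]
theorem res_mem_seqHistory {ops : List (σ × I)} {m : σ} {k : I} :
    Event.res m k ∈ seqHistory ops ↔ (m, k) ∈ ops := by
  simp [seqHistory]

theorem filter_seqHistory (p : Event σ I → Bool) (q : σ × I → Bool)
    (hinv : ∀ m k, p (Event.inv m k) = q (m, k))
    (hres : ∀ m k, p (Event.res m k) = q (m, k)) (ops : List (σ × I)) :
    (seqHistory ops).filter p = seqHistory (ops.filter q) := by
  induction ops with
  | nil => rfl
  | cons o ops ih => cases hq : q o <;> simp [hinv, hres, hq, ih]

theorem methodList_seqHistory (ops : List (σ × I)) :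
    methodList (seqHistory ops) = ops.map Prod.fst := by
  induction ops with
  | nil => rfl
  | cons o ops ih =>
    simpa [methodList, List.filter_cons, Event.isInv, Event.method] using ih

theorem precedes_seqHistory (ops : List (σ × I)) (m n : σ) :
    Precedes (seqHistory ops) m n ↔ OccursBefore (ops.map Prod.fst) m n := by
  rw [precedes_iff_occursBefore]
  induction ops with
  | nil => simp
  | cons o ops ih =>
    rw [List.map_cons, occursBefore_cons, ← ih]
    simp [exists_or]

theorem isChain_seqHistory (ops : List (σ × I)) (k : I) (hk : ∀ o ∈ ops, o.2 = k) :
    (seqHistory ops).IsChain fun e e' => ∀ m, e = Event.inv m k → e' = Event.res m k := by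
  induction ops with
  | nil => simp
  | cons o ops ih =>
    have hok := hk o List.mem_cons_self
    have ih := ih fun o ho => hk o (List.mem_cons_of_mem _ ho)
    rw [seqHistory_cons, List.isChain_cons_cons, List.isChain_cons]
    simp [ih, hok]

theorem isHistory_seqHistory {ops : List (σ × I)} (hops : (ops.map Prod.fst).Nodup) :
    IsHistory (seqHistory ops) := by
  have hnodup : (seqHistory ops).Nodup := by
    induction ops with
    | nil => simp
    | cons o ops ih =>
      rw [List.map_cons, List.nodup_cons] at hops
      have ho : o ∉ ops := fun ho => hops.1 (List.mem_map_of_mem ho)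
      simp [ih hops.2, ho]
  refine ⟨hnodup, ?_, ?_, ?_⟩
  · intro i j m k k' hi hj
    have hk := inv_mem_seqHistory.1 (hi ▸ List.get_mem (seqHistory ops) i)
    have hk' := inv_mem_seqHistory.1 (hj ▸ List.get_mem (seqHistory ops) j)
    obtain rfl : k = k' := congrArg Prod.snd (List.inj_on_of_nodup_map hops hk hk' rfl)
    exact List.nodup_iff_injective_get.1 hnodup (hi.trans hj.symm)
  · intro j m k hj
    have hocc : ∀ l : List (σ × I), (m, k) ∈ l →
        OccursBefore (seqHistory l) (Event.inv m k) (Event.res m k) := by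
      intro l hl
      induction l with
      | nil => simp at hl
      | cons o l ih =>
        rcases List.mem_cons.1 hl with rfl | hl
        · simp
        · simp [ih hl]
    obtain ⟨i, j', hij, hi, hj'⟩ :=
      hocc ops (res_mem_seqHistory.1 (hj ▸ List.get_mem (seqHistory ops) j))
    obtain rfl : j' = j := List.nodup_iff_injective_get.1 hnodup (hj'.trans hj.symm)
    exact ⟨i, hij, hi⟩
  · classical
    intro k i m hi e he
    have hfilter : threadEvents (seqHistory ops) k =
        seqHistory (ops.filter fun o => decide (o.2 = k)) :=
      filter_seqHistory _ _ (fun _ _ => rfl) (fun _ _ => rfl) ops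
    rw [hfilter] at hi he
    obtain ⟨_, hi⟩ := List.getElem?_eq_some_iff.1 hi
    obtain ⟨hlt, he⟩ := List.getElem?_eq_some_iff.1 he
    have hchain := isChain_seqHistory (ops.filter fun o => decide (o.2 = k)) k (by simp)
    rw [← he]
    exact List.isChain_iff_getElem.1 hchain i hlt m hi

theorem isCompletionOf_seqHistory {ops : List (σ × I)}
    (hops : (ops.map Prod.fst).Nodup) (hc : List (Event σ I)) :
    IsCompletionOf hc (seqHistory ops) ↔ hc = seqHistory ops :=
  isCompletionOf_iff_eq (isHistory_seqHistory hops)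
    (fun _ _ h => res_mem_seqHistory.2 (inv_mem_seqHistory.1 h)) hc

theorem linearizable_seqHistory {S : Set (List σ)} {ops : List (σ × I)}
    (hops : (ops.map Prod.fst).Nodup) :
    Linearizable S (seqHistory ops) ↔ ∃ s ∈ S, s.Perm (ops.map Prod.fst) ∧
      ∀ m n, OccursBefore (ops.map Prod.fst) m n → OccursBefore s m n := by
  simp only [Linearizable, isCompletionOf_seqHistory hops, exists_eq_left,
    methodList_seqHistory, precedes_seqHistory]

theorem seqConsistent_seqHistory {S : Set (List σ)} {ops : List (σ × I)}
    (hops : (ops.map Prod.fst).Nodup) :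
    SeqConsistent S (seqHistory ops) ↔ ∃ s ∈ S, s.Perm (ops.map Prod.fst) ∧
      ∀ m n, OccursBefore (ops.map Prod.fst) m n →
        (∃ k, (m, k) ∈ ops ∧ (n, k) ∈ ops) → OccursBefore s m n := by
  simp only [SeqConsistent, isCompletionOf_seqHistory hops, exists_eq_left,
    methodList_seqHistory, precedes_seqHistory, inv_mem_seqHistory]

open Classical in
theorem threadInduced_seqHistory (ops : List (CMethod V E × I)) (T : I) :
    threadInduced (seqHistory ops) T =
      seqHistory (ops.filter fun o => decide (InducedMethod (seqHistory ops) T o.1)) :=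
  filter_seqHistory _ _ (fun _ _ => rfl) (fun _ _ => rfl) ops

theorem linearizable_seqHistory_of_mem {S : Set (List σ)} {ops : List (σ × I)}
    (hops : (ops.map Prod.fst).Nodup) (hS : ops.map Prod.fst ∈ S) :
    Linearizable S (seqHistory ops) :=
  (linearizable_seqHistory hops).2 ⟨_, hS, List.Perm.refl _, fun _ _ h => h⟩

end SequentialHistories

section Witnesses

variable {V E I : Type*} {x y z : V} {T₁ T₂ : I}

theorem exists_seqConsistent_not_locallyLinearizable (x : V) (hT : T₁ ≠ T₂) :
    ∃ h : List (Event (CMethod V E) I), IsHistory h ∧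
      SeqConsistent (stackSpec V E) h ∧ ¬ LocallyLinearizable (stackSpec V E) h := by
  classical
  let ops : List (CMethod V E × I) := [(.rem (.inl x), T₂), (.ins x, T₁)]
  have hops : (ops.map Prod.fst).Nodup := by simp [ops]
  refine ⟨seqHistory ops, isHistory_seqHistory hops, ?_, ?_⟩
  · refine (seqConsistent_seqHistory hops).2 ⟨[.ins x, .rem (.inl x)], ?_, ?_, ?_⟩
    · simp [stackSpec, poolSpec]
    · exact List.Perm.swap _ _ _
    · rintro m n hmn ⟨k, hm, hn⟩
      simp only [ops, List.map_cons, List.map_nil, occursBefore_cons, List.mem_singleton,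
        List.not_mem_nil, and_false, occursBefore_nil, or_false] at hmn
      obtain ⟨rfl, rfl⟩ := hmn
      simp only [ops, List.mem_cons, Prod.mk.injEq, reduceCtorEq, false_and, true_and,
        List.not_mem_nil, or_false, false_or] at hm hn
      exact absurd (hn.symm.trans hm) hT
  · intro hLL
    have hlin := hLL.1 T₁
    have hfilter : ops.filter
        (fun o => decide (InducedMethod (seqHistory ops) T₁ o.1)) = ops := by
      simp [ops, InducedMethod]
    rw [threadInduced_seqHistory, hfilter, linearizable_seqHistory hops] at hlin
    obtain ⟨s, ⟨⟨hnodup, hpop, -⟩, -⟩, hperm, hord⟩ := hlin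
    have hmem : CMethod.rem (.inl x) ∈ s := hperm.mem_iff.2 (by simp [ops])
    exact (hpop x hmem).2.asymm hnodup (hord _ _ (by simp [ops]))

theorem exists_locallyLinearizable_not_seqConsistent (hxy : x ≠ y) (hxz : x ≠ z)
    (hyz : y ≠ z) (hT : T₁ ≠ T₂) :
    ∃ h : List (Event (CMethod V E) I), IsHistory h ∧
      LocallyLinearizable (stackSpec V E) h ∧ ¬ SeqConsistent (stackSpec V E) h := by
  classical
  let ops : List (CMethod V E × I) :=
    [(.ins x, T₁), (.ins z, T₁), (.rem (.inl z), T₂), (.ins y, T₂), (.rem (.inl x), T₂)]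
  have hops : (ops.map Prod.fst).Nodup := by
    simp [ops, hxy, hxz, hyz.symm, hxz.symm]
  refine ⟨seqHistory ops, isHistory_seqHistory hops, ⟨fun T => ?_, ?_⟩, ?_⟩
  · rw [threadInduced_seqHistory]
    refine linearizable_seqHistory_of_mem (hops.sublist (List.filter_sublist.map _)) ?_
    by_cases h₁ : T = T₁
    · subst h₁
      simp [ops, InducedMethod, hxy.symm, hxz, hxz.symm, hyz, hT, stackSpec, poolSpec]
    · by_cases h₂ : T = T₂
      · subst h₂
        simp [ops, InducedMethod, hxy, hyz.symm, hT.symm, stackSpec, poolSpec]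
      · simp [ops, InducedMethod, h₁, h₂, stackSpec, poolSpec]
  · rintro m ⟨k, hm⟩
    simp only [inv_mem_seqHistory, ops, List.mem_cons, Prod.mk.injEq, List.not_mem_nil,
      or_false] at hm
    rcases hm with ⟨rfl, -⟩ | ⟨rfl, -⟩ | ⟨rfl, -⟩ | ⟨rfl, -⟩ | ⟨rfl, -⟩
    · exact ⟨T₁, by simp [InducedMethod, ops]⟩
    · exact ⟨T₁, by simp [InducedMethod, ops]⟩
    · exact ⟨T₁, by simp [InducedMethod, ops]⟩
    · exact ⟨T₂, by simp [InducedMethod, ops]⟩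
    · exact ⟨T₁, by simp [InducedMethod, ops]⟩
  · rw [seqConsistent_seqHistory hops]
    rintro ⟨s, ⟨⟨hnodup, hpop, -⟩, hstack⟩, hperm, hord⟩
    have hxz' : OccursBefore s (.ins x) (.ins z) :=
      hord _ _ (by simp [ops]) ⟨T₁, by simp [ops]⟩
    have hzz : OccursBefore s (.ins z) (.rem (.inl z)) :=
      (hpop z (hperm.mem_iff.2 (by simp [ops]))).2
    have hzy : OccursBefore s (.rem (.inl z)) (.ins y) :=
      hord _ _ (by simp [ops]) ⟨T₂, by simp [ops]⟩
    have hyx : OccursBefore s (.ins y) (.rem (.inl x)) :=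
      hord _ _ (by simp [ops]) ⟨T₂, by simp [ops]⟩
    have hy := (hstack x y ((hxz'.trans hnodup hzz).trans hnodup hzy) hyx).1
    simpa [ops, hxy.symm, hyz] using hperm.mem_iff.1 hy

end Witnesses

/-- For stack, local linearizability is incomparable to sequential consistency. -/
theorem stack_locallyLinearizable_incomparable_seqConsistent
    (V E I : Type*) (x y z : V) (hxy : x ≠ y) (hxz : x ≠ z) (hyz : y ≠ z)
    (T₁ T₂ : I) (hT : T₁ ≠ T₂) :
    (∃ h : List (Event (CMethod V E) I), IsHistory h ∧
        SeqConsistent (stackSpec V E) h ∧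
        ¬ LocallyLinearizable (stackSpec V E) h) ∧
    (∃ h : List (Event (CMethod V E) I), IsHistory h ∧
        LocallyLinearizable (stackSpec V E) h ∧
        ¬ SeqConsistent (stackSpec V E) h) :=
  ⟨exists_seqConsistent_not_locallyLinearizable x hT,
    exists_locallyLinearizable_not_seqConsistent hxy hxz hyz hT⟩

end LL
end

section
/- Axiomatic characterization of queue local linearizability: a complete concurrent history h over Σ_Q is locally linearizable with respect to S_Q if and only if (1) h, with enq read as ins and deq read as rem, is locally linearizable with respect to the pool specification S_P, and (2) for all x, y ∈ V and every thread T: if enq(x) and enq(y) are both performed by thread T with enq(x) <_h enq(y), and deq(y) appears in h, then deq(x) appears in h and it is not the case that deq(y) <_h deq(x). -/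
namespace LL

section Sequences

variable {α : Type*}

lemma occursBefore_iff_sublist {l : List α} {a b : α} :
    OccursBefore l a b ↔ [a, b].Sublist l := by
  constructor
  · rintro ⟨i, j, hij, rfl, rfl⟩
    have hp : l.Pairwise fun a b => [a, b].Sublist l :=
      List.pairwise_iff_forall_sublist.2 fun h => h
    exact List.pairwise_iff_get.1 hp i j hij
  · intro h
    have hp : l.Pairwise (OccursBefore l) :=
      List.pairwise_iff_get.2 fun i j hij => ⟨i, j, hij, rfl, rfl⟩
    exact List.pairwise_iff_forall_sublist.1 hp h

lemma OccursBefore.mem_left {l : List α} {a b : α} (h : OccursBefore l a b) : a ∈ l :=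
  (occursBefore_iff_sublist.1 h).subset (by simp)

lemma OccursBefore.mem_right {l : List α} {a b : α} (h : OccursBefore l a b) : b ∈ l :=
  (occursBefore_iff_sublist.1 h).subset (by simp)

lemma OccursBefore.of_sublist {l l' : List α} {a b : α} (h : OccursBefore l a b)
    (hl : l.Sublist l') : OccursBefore l' a b :=
  occursBefore_iff_sublist.2 ((occursBefore_iff_sublist.1 h).trans hl)

lemma OccursBefore.filter {l : List α} {a b : α} (h : OccursBefore l a b) {p : α → Bool}
    (ha : p a = true) (hb : p b = true) : OccursBefore (l.filter p) a b := by
  have := (occursBefore_iff_sublist.1 h).filter p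
  rw [occursBefore_iff_sublist]
  simpa [ha, hb] using this

lemma occursBefore_iff_idxOf [DecidableEq α] {l : List α} (hl : l.Nodup) {a b : α} :
    OccursBefore l a b ↔ a ∈ l ∧ b ∈ l ∧ l.idxOf a < l.idxOf b := by
  constructor
  · intro h
    refine ⟨h.mem_left, h.mem_right, ?_⟩
    obtain ⟨i, j, hij, rfl, rfl⟩ := h
    simpa [hl.idxOf_getElem] using hij
  · rintro ⟨ha, hb, hab⟩
    exact ⟨⟨_, List.idxOf_lt_length_of_mem ha⟩, ⟨_, List.idxOf_lt_length_of_mem hb⟩, hab,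
      by simp, by simp⟩

lemma OccursBefore.asymm_s18 {l : List α} (hl : l.Nodup) {a b : α} (h : OccursBefore l a b) :
    ¬ OccursBefore l b a := by
  classical
  rw [occursBefore_iff_idxOf hl] at *
  omega

lemma exists_perm_sorted_by_key {κ : Type*} [LinearOrder κ] (f : α → κ) {s : List α}
    (hs : s.Nodup) : ∃ t : List α, t.Perm s ∧
      (∀ a b, OccursBefore t a b → f a ≤ f b) ∧
      ∀ a ∈ s, ∀ b ∈ s, f a < f b → OccursBefore t a b := by
  classical
  have hperm := List.mergeSort_perm s fun a b => decide (f a ≤ f b)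
  have hsort : (s.mergeSort fun a b => decide (f a ≤ f b)).Pairwise fun a b => f a ≤ f b := by
    have := List.pairwise_mergeSort (le := fun a b => decide (f a ≤ f b))
      (by simpa using fun a b c => le_trans) (by simpa using fun a b => le_total _ _) s
    simpa using this
  have hle : ∀ a b, OccursBefore (s.mergeSort fun a b => decide (f a ≤ f b)) a b → f a ≤ f b :=
    fun a b hab => List.pairwise_iff_forall_sublist.1 hsort (occursBefore_iff_sublist.1 hab)
  refine ⟨_, hperm, hle, fun a ha b hb hab => ?_⟩
  have hnd := hperm.nodup_iff.2 hs
  rw [occursBefore_iff_idxOf hnd]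
  refine ⟨hperm.mem_iff.2 ha, hperm.mem_iff.2 hb, ?_⟩
  by_contra! hlt
  rcases hlt.lt_or_eq with hlt | heq
  · exact hab.not_ge (hle b a ((occursBefore_iff_idxOf hnd).2
      ⟨hperm.mem_iff.2 hb, hperm.mem_iff.2 ha, hlt⟩))
  · rw [(List.idxOf_inj (hperm.mem_iff.2 hb)).1 heq] at hab
    exact hab.false

end Sequences

section QueueReordering

variable {V E : Type*}

open Classical in
/-- The position following the last empty removal at or before `m` in `s`. -/
noncomputable def lastEmpty (s : List (CMethod V E)) (m : CMethod V E) : ℕ :=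
  (s.toFinset.filter fun n => (∃ e, n = .rem (.inr e)) ∧ s.idxOf n ≤ s.idxOf m).sup
    fun n => s.idxOf n + 1

open Classical in
/-- The latest invocation, according to `iv`, among the insertion of `x` and the removals in `s`
of the values inserted no later than `x`. -/
noncomputable def removalPoint (iv : CMethod V E → ℕ) (s : List (CMethod V E)) (x : V) : ℕ :=
  max (iv (.ins x))
    ((s.toFinset.filter fun n => ∃ y, n = .rem (.inl y) ∧ iv (.ins y) ≤ iv (.ins x)).sup iv)

/-- The position of a method call within its segment between two empty removals. -/
noncomputable def segmentKey (iv : CMethod V E → ℕ) (s : List (CMethod V E)) :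
    CMethod V E → ℕ ×ₗ ℕ
  | .ins x => toLex (iv (.ins x) + 1, 0)
  | .rem (.inl x) => toLex (removalPoint iv s x + 1, iv (.ins x) + 1)
  | .rem (.inr _) => toLex (0, 0)

open Classical in
lemma lastEmpty_mono {s : List (CMethod V E)} {m n : CMethod V E}
    (h : s.idxOf m ≤ s.idxOf n) : lastEmpty s m ≤ lastEmpty s n := by
  refine Finset.sup_mono fun a => ?_
  simp only [Finset.mem_filter]
  exact fun ⟨h1, h2, h3⟩ => ⟨h1, h2, h3.trans h⟩

lemma lastEmpty_lt_of_occursBefore {s : List (CMethod V E)} (hs : s.Nodup) {m : CMethod V E}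
    {e : E} (h : OccursBefore s m (.rem (.inr e))) :
    lastEmpty s m < lastEmpty s (.rem (.inr e)) := by
  classical
  obtain ⟨_, he, hlt⟩ := (occursBefore_iff_idxOf hs).1 h
  calc lastEmpty s m ≤ s.idxOf m + 1 := by
        refine Finset.sup_le fun n hn => ?_
        simp only [Finset.mem_filter] at hn
        omega
    _ ≤ s.idxOf (CMethod.rem (.inr e)) := hlt
    _ < s.idxOf (CMethod.rem (.inr e)) + 1 := Nat.lt_succ_self _
    _ ≤ lastEmpty s (.rem (.inr e)) :=
        Finset.le_sup (f := fun n => s.idxOf n + 1) (by simpa using he)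

lemma lastEmpty_rem_eq {s : List (CMethod V E)} (hs : s ∈ poolSpec V E) {x : V}
    (hx : .rem (.inl x) ∈ s) : lastEmpty s (.rem (.inl x)) = lastEmpty s (.ins x) := by
  classical
  obtain ⟨hnd, hrem, hemp⟩ := hs
  have hlt := (occursBefore_iff_idxOf hnd).1 (hrem x hx).2
  refine le_antisymm (Finset.sup_mono fun n => ?_) (lastEmpty_mono hlt.2.2.le)
  simp only [Finset.mem_filter, List.mem_toFinset]
  rintro ⟨hn, ⟨e, rfl⟩, hle⟩
  refine ⟨hn, ⟨e, rfl⟩, ?_⟩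
  by_contra! hgt
  have := (occursBefore_iff_idxOf hnd).1
    (hemp e x ((occursBefore_iff_idxOf hnd).2 ⟨hlt.1, hn, hgt⟩)).2
  omega

lemma removalPoint_mono (iv : CMethod V E → ℕ) (s : List (CMethod V E)) {x y : V}
    (h : iv (.ins x) ≤ iv (.ins y)) : removalPoint iv s x ≤ removalPoint iv s y := by
  classical
  refine max_le_max h (Finset.sup_mono fun a => ?_)
  simp only [Finset.mem_filter]
  exact fun ⟨h1, y, h2, h3⟩ => ⟨h1, y, h2, h3.trans h⟩

/-- A linearization wrt the pool specification of method calls with totally ordered insertions and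
no removal order violation can be rearranged into one wrt the queue specification. Here `iv` and
`rs` are the invocation and response times. -/
theorem exists_queue_reordering {s : List (CMethod V E)} (hs : s ∈ poolSpec V E)
    (iv rs : CMethod V E → ℕ) (hiv : ∀ m ∈ s, iv m < rs m)
    (hprec : ∀ m ∈ s, ∀ n ∈ s, rs m < iv n → OccursBefore s m n)
    (htot : ∀ x y, .ins x ∈ s → .ins y ∈ s → x ≠ y →
      rs (.ins x) < iv (.ins y) ∨ rs (.ins y) < iv (.ins x))
    (hfifo : ∀ x y, .ins x ∈ s → .ins y ∈ s → rs (.ins x) < iv (.ins y) →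
      .rem (.inl y) ∈ s → .rem (.inl x) ∈ s ∧ ¬ rs (.rem (.inl y)) < iv (.rem (.inl x))) :
    ∃ t ∈ queueSpec V E, t.Perm s ∧
      ∀ m ∈ s, ∀ n ∈ s, rs m < iv n → OccursBefore t m n := by
  classical
  obtain ⟨hnd, hrem, hemp⟩ := id hs
  have hpoint : ∀ x, .rem (.inl x) ∈ s → removalPoint iv s x ≤ rs (.rem (.inl x)) := by
    intro x hx
    have hix := (hrem x hx).1
    refine max_le ?_ (Finset.sup_le fun n hn => ?_)
    · by_contra! hlt
      exact (hrem x hx).2.asymm_s18 hnd (hprec _ hx _ hix hlt)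
    · simp only [Finset.mem_filter, List.mem_toFinset] at hn
      obtain ⟨hn, y, rfl, hyx⟩ := hn
      by_cases hxy : y = x
      · exact hxy ▸ (hiv _ hn).le
      · have hiy := (hrem y hn).1
        rcases htot y x hiy hix hxy with h | h
        · exact not_lt.1 (hfifo y x hiy hix h hx).2
        · have := hiv _ hix
          omega
  have hpoint' : ∀ x, .rem (.inl x) ∈ s → iv (.rem (.inl x)) ≤ removalPoint iv s x := by
    intro x hx
    refine le_max_of_le_right (Finset.le_sup (f := iv) ?_)
    simp [hx]
  obtain ⟨t, hperm, hle, hlt⟩ := exists_perm_sorted_by_key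
    (fun m => toLex (lastEmpty s m, segmentKey iv s m)) hnd
  have hmem : ∀ m, m ∈ t ↔ m ∈ s := fun m => hperm.mem_iff
  have htprec : ∀ m ∈ s, ∀ n ∈ s, rs m < iv n → OccursBefore t m n := by
    intro m hm n hn hmn
    have hob := hprec m hm n hn hmn
    refine hlt m hm n hn (Prod.Lex.toLex_lt_toLex.2 ?_)
    have hmono := lastEmpty_mono ((occursBefore_iff_idxOf hnd).1 hob).2.2.le
    refine hmono.lt_or_eq.imp_right fun heq => ⟨heq, ?_⟩
    have := hiv m hm
    rcases m with x | x | e <;> rcases n with y | y | e' <;>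
      first
      | exact absurd heq (lastEmpty_lt_of_occursBefore hnd hob).ne
      | (refine Prod.Lex.toLex_lt_toLex.2 (Or.inl ?_)
         try have := hpoint _ hm
         try have := hpoint' _ hn
         simp only
         omega)
  refine ⟨t, ⟨⟨hperm.nodup_iff.2 hnd, fun x hx => ?_, fun e x hex => ?_⟩,
    fun x y hxy hy => ?_⟩, hperm, htprec⟩
  · rw [hmem] at hx
    have hix := (hrem x hx).1
    refine ⟨(hmem _).2 hix, hlt _ hix _ hx (Prod.Lex.toLex_lt_toLex.2 (Or.inr ?_))⟩
    refine ⟨(lastEmpty_rem_eq hs hx).symm, Prod.Lex.toLex_lt_toLex.2 ?_⟩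
    have : iv (.ins x) ≤ removalPoint iv s x := le_max_left _ _
    simp only
    omega
  · have hx := (hmem _).1 hex.mem_left
    have he := (hmem _).1 hex.mem_right
    have hlast : lastEmpty s (.ins x) < lastEmpty s (.rem (.inr e)) := by
      rcases Prod.Lex.toLex_le_toLex.1 (hle _ _ hex) with h | ⟨_, h⟩
      · exact h
      · rcases Prod.Lex.toLex_le_toLex.1 h with h | ⟨h, _⟩ <;> simp at h
    have hob : OccursBefore s (.ins x) (.rem (.inr e)) := by
      refine (occursBefore_iff_idxOf hnd).2 ⟨hx, he, ?_⟩
      by_contra! h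
      exact (lastEmpty_mono h).not_gt hlast
    have hr := (hemp e x hob).1
    refine ⟨(hmem _).2 hr, hlt _ hr _ he (Prod.Lex.toLex_lt_toLex.2 (Or.inl ?_))⟩
    simpa only [lastEmpty_rem_eq hs hr] using hlast
  · have hix := (hmem _).1 hxy.mem_left
    have hiy := (hmem _).1 hxy.mem_right
    have hy := (hmem _).1 hy
    have htnd := hperm.nodup_iff.2 hnd
    have hne : x ≠ y := by
      rintro rfl
      exact hxy.asymm_s18 htnd hxy
    have hlt' : rs (.ins x) < iv (.ins y) := (htot x y hix hiy hne).resolve_right fun h =>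
      hxy.asymm_s18 htnd (htprec _ hiy _ hix h)
    have hx := (hfifo x y hix hiy hlt' hy).1
    refine ⟨(hmem _).2 hx, hlt _ hx _ hy (Prod.Lex.toLex_lt_toLex.2 ?_)⟩
    have hlast := lastEmpty_mono ((occursBefore_iff_idxOf hnd).1 (hprec _ hix _ hiy hlt')).2.2.le
    simp only [lastEmpty_rem_eq hs hx, lastEmpty_rem_eq hs hy]
    refine hlast.lt_or_eq.imp_right fun heq => ⟨heq, Prod.Lex.toLex_lt_toLex.2 ?_⟩
    have hixy : iv (.ins x) < iv (.ins y) := (hiv _ hix).trans hlt'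
    have := removalPoint_mono iv s hixy.le
    simp only
    omega

end QueueReordering

section Histories

variable {σ I : Type*}

lemma precedes_iff {h : List (Event σ I)} {m n : σ} :
    Precedes h m n ↔ ∃ k k', OccursBefore h (.res m k) (.inv n k') :=
  ⟨fun ⟨i, j, k, k', hij, hi, hj⟩ => ⟨k, k', i, j, hij, hi, hj⟩,
    fun ⟨k, k', i, j, hij, hi, hj⟩ => ⟨i, j, k, k', hij, hi, hj⟩⟩

lemma mem_methodList {h : List (Event σ I)} {m : σ} : m ∈ methodList h ↔ Appears h m := by
  simp only [methodList, List.mem_map, List.mem_filter, Appears]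
  constructor
  · rintro ⟨⟨m, k⟩ | ⟨m, k⟩, ⟨he, hi⟩, rfl⟩
    · exact ⟨k, he⟩
    · cases hi
  · rintro ⟨k, hk⟩
    exact ⟨_, ⟨hk, rfl⟩, rfl⟩

lemma IsHistory.thread_unique {h : List (Event σ I)} (hh : IsHistory h) {m : σ} {k k' : I}
    (hk : .inv m k ∈ h) (hk' : .inv m k' ∈ h) : k = k' := by
  obtain ⟨i, hi⟩ := List.mem_iff_get.1 hk
  obtain ⟨j, hj⟩ := List.mem_iff_get.1 hk'
  have := hh.invUnique i j m k k' hi hj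
  subst this
  rw [hi] at hj
  injection hj

lemma IsHistory.inv_before_res {h : List (Event σ I)} (hh : IsHistory h) {m : σ} {k : I}
    (hk : .res m k ∈ h) : OccursBefore h (.inv m k) (.res m k) := by
  obtain ⟨j, hj⟩ := List.mem_iff_get.1 hk
  obtain ⟨i, hij, hi⟩ := hh.resMatched j m k hj
  exact ⟨i, j, hij, hi, hj⟩

lemma IsHistory.res_before_inv_of_same_thread {h : List (Event σ I)} (hh : IsHistory h)
    {m n : σ} {k : I} (hmn : OccursBefore h (.inv m k) (.inv n k)) :
    OccursBefore h (.res m k) (.inv n k) := by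
  classical
  have hsub : (threadEvents h k).Sublist h := List.filter_sublist
  have hob : OccursBefore (threadEvents h k) (.inv m k) (.inv n k) :=
    hmn.filter (by simp [Event.thread]) (by simp [Event.thread])
  obtain ⟨i, j, hij, hi, hj⟩ := hob
  have hlt : (i : ℕ) + 1 < (threadEvents h k).length := by omega
  have hres := hh.threadSeq k i m (by simpa [List.getElem?_eq_some_iff] using hi)
    _ (List.getElem?_eq_getElem hlt)
  refine OccursBefore.of_sublist ⟨⟨i + 1, hlt⟩, j, ?_, hres, hj⟩ hsub
  refine lt_of_le_of_ne (Nat.succ_le_of_lt hij) ?_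
  rintro rfl
  have : Event.res m k = Event.inv n k := hres.symm.trans hj
  cases this

lemma IsCompletionOf.eq_of_complete {hc h : List (Event σ I)} (hcompl : IsCompletionOf hc h)
    (hnd : h.Nodup) (hcomp : HistComplete h) : hc = h := by
  obtain ⟨-, -, h', r, hsub, hdel, happ, rfl⟩ := hcompl
  have hr : r = [] := List.eq_nil_iff_forall_not_mem.2 fun e he => by
    obtain ⟨m, k, -, h1, h2⟩ := happ e he
    exact h2 (hcomp m k h1)
  have hsup : h ⊆ h' := fun e he => by
    by_contra hne
    obtain ⟨m, k, -, h1, h2⟩ := hdel e he hne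
    exact h2 (hcomp m k h1)
  rw [hr, List.append_nil]
  exact hsub.eq_of_length_le (hnd.subperm hsup).length_le

/-- Invocation and response times of the method calls of a complete history. -/
lemma IsHistory.exists_times {h : List (Event σ I)} (hh : IsHistory h) (hcomp : HistComplete h) :
    ∃ iv rs : σ → ℕ, (∀ m, Appears h m → iv m < rs m) ∧
      (∀ m n, Appears h m → Appears h n → (Precedes h m n ↔ rs m < iv n)) ∧
      ∀ m n k, .inv m k ∈ h → .inv n k ∈ h → m ≠ n → rs m < iv n ∨ rs n < iv m := by
  classical
  let iv : σ → ℕ := fun m => if hm : Appears h m then h.idxOf (.inv m hm.choose) else 0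
  let rs : σ → ℕ := fun m => if hm : Appears h m then h.idxOf (.res m hm.choose) else 0
  have hiv : ∀ m k, .inv m k ∈ h → iv m = h.idxOf (.inv m k) := fun m k hk => by
    have hm : Appears h m := ⟨k, hk⟩
    simp only [iv, hm, dif_pos]
    rw [hh.thread_unique hm.choose_spec hk]
  have hrs : ∀ m k, .inv m k ∈ h → rs m = h.idxOf (.res m k) := fun m k hk => by
    have hm : Appears h m := ⟨k, hk⟩
    simp only [rs, hm, dif_pos]
    rw [hh.thread_unique hm.choose_spec hk]
  have hob := fun a b => occursBefore_iff_idxOf (a := a) (b := b) hh.nodup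
  refine ⟨iv, rs, ?_, ?_, ?_⟩
  · rintro m ⟨k, hk⟩
    rw [hiv m k hk, hrs m k hk]
    exact ((hob _ _).1 (hh.inv_before_res (hcomp m k hk))).2.2
  · rintro m n ⟨k, hk⟩ ⟨k', hk'⟩
    rw [hiv n k' hk', hrs m k hk, precedes_iff]
    constructor
    · rintro ⟨l, l', hll⟩
      have hl := (hh.inv_before_res hll.mem_left).mem_left
      rw [hh.thread_unique hk hl, hh.thread_unique hk' hll.mem_right]
      exact ((hob _ _).1 hll).2.2
    · exact fun hlt => ⟨k, k', (hob _ _).2 ⟨hcomp m k hk, hk', hlt⟩⟩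
  · intro m n k hm hn hne
    rw [hiv m k hm, hrs m k hm, hiv n k hn, hrs n k hn]
    rcases lt_trichotomy (h.idxOf (.inv m k)) (h.idxOf (.inv n k)) with hlt | heq | hlt
    · exact Or.inl ((hob _ _).1 (hh.res_before_inv_of_same_thread
        ((hob _ _).2 ⟨hm, hn, hlt⟩))).2.2
    · have := (List.idxOf_inj hm).1 heq
      injection this with h1
      exact absurd h1 hne
    · exact Or.inr ((hob _ _).1 (hh.res_before_inv_of_same_thread
        ((hob _ _).2 ⟨hn, hm, hlt⟩))).2.2

end Histories

section ThreadInduced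

variable {V E I : Type*} {h : List (Event (CMethod V E) I)} {T : I}

lemma mem_threadInduced {e : Event (CMethod V E) I} :
    e ∈ threadInduced h T ↔ e ∈ h ∧ InducedMethod h T e.method := by
  simp [threadInduced]

lemma HistComplete.threadInduced (hcomp : HistComplete h) :
    HistComplete (threadInduced h T) := fun m k hk => by
  rw [mem_threadInduced] at hk ⊢
  exact ⟨hcomp m k hk.1, hk.2⟩

lemma appears_threadInduced {m : CMethod V E} :
    Appears (threadInduced h T) m ↔ Appears h m ∧ InducedMethod h T m := by
  simp [Appears, mem_threadInduced, Event.method]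

lemma precedes_threadInduced {m n : CMethod V E} (hm : InducedMethod h T m)
    (hn : InducedMethod h T n) : Precedes (threadInduced h T) m n ↔ Precedes h m n := by
  simp only [precedes_iff]
  refine exists_congr fun k => exists_congr fun k' => ⟨fun hp => hp.of_sublist ?_, fun hp => ?_⟩
  · exact List.filter_sublist
  · exact hp.filter (by simp only [decide_eq_true_eq]; exact hm)
      (by simp only [decide_eq_true_eq]; exact hn)

end ThreadInduced

lemma Linearizable.mono {σ I : Type*} {S S' : Set (List σ)} (hS : S ⊆ S')
    {h : List (Event σ I)} (hl : Linearizable S h) : Linearizable S' h := by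
  obtain ⟨hc, hcompl, s, hs, hrest⟩ := hl
  exact ⟨hc, hcompl, s, hS hs, hrest⟩

/-- Axiomatic characterization of queue local linearizability: a complete
history is locally linearizable wrt the queue specification iff it is locally
linearizable wrt the pool specification and satisfies the per-thread concurrent
queue order axiom. -/
theorem queue_local_linearizability_characterization
    (V E I : Type*) (h : List (Event (CMethod V E) I))
    (hh : IsHistory h) (hcomp : HistComplete h) :
    LocallyLinearizable (queueSpec V E) h ↔
      (LocallyLinearizable (poolSpec V E) h ∧
        ∀ (x y : V) (T : I),
          Event.inv (CMethod.ins x) T ∈ h → Event.inv (CMethod.ins y) T ∈ h →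
          Precedes h (CMethod.ins x) (CMethod.ins y) →
          Appears h (CMethod.rem (Sum.inl y)) →
          Appears h (CMethod.rem (Sum.inl x)) ∧
          ¬ Precedes h (CMethod.rem (Sum.inl y)) (CMethod.rem (Sum.inl x))) := by
  constructor
  · rintro ⟨hlin, hdec⟩
    refine ⟨⟨fun T => (hlin T).mono fun s hs => hs.1, hdec⟩, ?_⟩
    intro x y T hx hy hxy hry
    obtain ⟨hc, hcompl, s, hs, hperm, hprec⟩ := hlin T
    obtain rfl := hcompl.eq_of_complete (hh.nodup.filter _) hcomp.threadInduced
    have hmem : ∀ m, m ∈ s ↔ Appears h m ∧ InducedMethod h T m := fun m => by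
      rw [hperm.mem_iff, mem_methodList, appears_threadInduced]
    have hob := hprec _ _ ((precedes_threadInduced (m := .ins x) (n := .ins y) hx hy).2 hxy)
    obtain ⟨hrx, hrob⟩ := hs.2 x y hob ((hmem _).2 ⟨hry, hy⟩)
    refine ⟨((hmem _).1 hrx).1, fun hp => hrob.asymm_s18 hs.1.1 (hprec _ _ ?_)⟩
    exact (precedes_threadInduced (m := .rem (.inl y)) (n := .rem (.inl x)) hy hx).2 hp
  · rintro ⟨⟨hlin, hdec⟩, hfifo⟩
    refine ⟨fun T => ?_, hdec⟩
    obtain ⟨hc, hcompl, s, hs, hperm, hprec⟩ := hlin T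
    obtain rfl := hcompl.eq_of_complete (hh.nodup.filter _) hcomp.threadInduced
    have hmem : ∀ m, m ∈ s ↔ Appears h m ∧ InducedMethod h T m := fun m => by
      rw [hperm.mem_iff, mem_methodList, appears_threadInduced]
    obtain ⟨iv, rs, hlt, hiff, htot⟩ := hh.exists_times hcomp
    have hiff' : ∀ m ∈ s, ∀ n ∈ s, (Precedes (threadInduced h T) m n ↔ rs m < iv n) :=
      fun m hm n hn => by
        rw [hmem] at hm hn
        rw [precedes_threadInduced hm.2 hn.2, hiff m n hm.1 hn.1]
    obtain ⟨t, ht, htperm, htprec⟩ := exists_queue_reordering hs iv rs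
      (fun m hm => hlt m ((hmem m).1 hm).1)
      (fun m hm n hn hmn => hprec m n ((hiff' m hm n hn).2 hmn))
      (fun x y hx hy hxy => htot _ _ T ((hmem _).1 hx).2 ((hmem _).1 hy).2 (by simpa using hxy))
      (fun x y hx hy hxy hry => by
        rw [hmem] at hx hy hry
        obtain ⟨hrx, hnp⟩ := hfifo x y T hx.2 hy.2 ((hiff _ _ hx.1 hy.1).2 hxy) hry.1
        exact ⟨(hmem _).2 ⟨hrx, hx.2⟩, fun hp => hnp ((hiff _ _ hry.1 hrx).2 hp)⟩)
    refine ⟨_, hcompl, t, ht, htperm.trans hperm, fun m n hmn => ?_⟩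
    have hob := hprec m n hmn
    exact htprec m hob.mem_left n hob.mem_right ((hiff' m hob.mem_left n hob.mem_right).1 hmn)

end LL
end
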